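/- Let X be Polish, μ0 a Borel probability measure, H ⊆ C_b(X) a linear subspace containing constants with superhedging functional φ continuous from above, and let H^1 ⊆ H^2 ⊆ ⋯ be subsets of H with union H^∞ = ∪_{m∈ℕ} H^m, where H^∞ is a linear subspace of C_b(X) containing the constant functions. Define φ^m(f) = inf{∫ h dμ0 : h ∈ H^m, h ≥ f} and φ^∞(f) = inf{∫ h dμ0 : h ∈ H^∞, h ≥ f}. Assume Condition (D): for every ε > 0 and every Borel probability measure μ on X, (a) for every h ∈ H there exists h′ ∈ H^∞ with ∫ |h − h′| dμ ≤ ε, and (b) there exist h″ ∈ H^∞ and a compact K ⊆ X with 1_{K^c} ≤ h″ and ∫ h″ dμ ≤ ε. Then for every f ∈ C_b(X), lim_{m→∞} φ^m(f) = φ^∞(f) = φ(f). -/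

import Mathlib

open MeasureTheory BoundedContinuousFunction Filter Topology

/-- The superhedging functional `φ(f) = inf {∫ h dμ0 : h ∈ H, h ≥ f}`. -/
noncomputable def phi {X : Type*} [TopologicalSpace X] [MeasurableSpace X]
    (μ0 : Measure X) (H : Set (X →ᵇ ℝ)) (f : X →ᵇ ℝ) : ℝ :=
  sInf {r : ℝ | ∃ h ∈ H, (∀ x, f x ≤ h x) ∧ r = ∫ x, h x ∂μ0}

open scoped CompactlySupported

section Representation

variable {X : Type*} [TopologicalSpace X]

/-- The restriction to `X` of a continuous function on its Stone–Čech compactification. -/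
noncomputable def stoneCechRestrict (u : C(StoneCech X, ℝ)) : X →ᵇ ℝ :=
  (mkOfCompact u).compContinuous ⟨stoneCechUnit, continuous_stoneCechUnit⟩

@[simp]
lemma stoneCechRestrict_apply (u : C(StoneCech X, ℝ)) (x : X) :
    stoneCechRestrict u x = u (stoneCechUnit x) := rfl

lemma stoneCechRestrict_surjective :
    Function.Surjective (stoneCechRestrict : C(StoneCech X, ℝ) → X →ᵇ ℝ) := by
  intro g
  let G : X → Metric.closedBall (0 : ℝ) ‖g‖ :=
    fun x => ⟨g x, by simpa using g.norm_coe_le_norm x⟩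
  have hG : Continuous G := by fun_prop
  refine ⟨⟨fun y => (stoneCechExtend hG y).1,
    continuous_subtype_val.comp (continuous_stoneCechExtend hG)⟩, ?_⟩
  ext x
  simp [stoneCechExtend_stoneCechUnit, G]

/-- A positive linear functional on `C_b(X)` which is tight is integration against a finite
Borel measure. -/
theorem exists_measure_integral_eq_of_tight [T35Space X] [MeasurableSpace X] [BorelSpace X]
    (l : (X →ᵇ ℝ) →ₗ[ℝ] ℝ) (hpos : ∀ g, 0 ≤ g → 0 ≤ l g)
    (htight : ∀ ε > (0 : ℝ), ∃ h : X →ᵇ ℝ, ∃ K : Set X, IsCompact K ∧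
      (∀ x, Kᶜ.indicator (fun _ => (1 : ℝ)) x ≤ h x) ∧ l h ≤ ε) :
    ∃ ν : Measure X, IsFiniteMeasure ν ∧ ∀ g : X →ᵇ ℝ, ∫ x, g x ∂ν = l g := by
  let : MeasurableSpace (StoneCech X) := borel _
  have : BorelSpace (StoneCech X) := ⟨rfl⟩
  let i : X → StoneCech X := stoneCechUnit
  have hi : IsEmbedding i := isEmbedding_stoneCechUnit
  let L : C_c(StoneCech X, ℝ) →ₚ[ℝ] ℝ := PositiveLinearMap.mk₀
    { toFun := fun u => l (stoneCechRestrict u.toContinuousMap)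
      map_add' := fun u v => by rw [← map_add]; rfl
      map_smul' := fun c u => by rw [RingHom.id_apply, ← map_smul]; rfl }
    (fun u hu => hpos _ fun x => hu (i x))
  let m : Measure (StoneCech X) := RealRMK.rieszMeasure L
  have hm (u : C(StoneCech X, ℝ)) : ∫ y, u y ∂m = l (stoneCechRestrict u) :=
    RealRMK.integral_rieszMeasure L ⟨u, HasCompactSupport.of_compactSpace u⟩
  have hsmall (ε : ℝ) (hε : 0 < ε) : ∃ K : Set X, IsCompact K ∧
      m (i '' K)ᶜ ≤ ENNReal.ofReal ε := by
    obtain ⟨h, K, hK, hKh, hlh⟩ := htight ε hε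
    obtain ⟨u, rfl⟩ := stoneCechRestrict_surjective h
    have hiK : IsClosed (i '' K) := (hK.image hi.continuous).isClosed
    have hu0 (y : StoneCech X) : 0 ≤ u y := by
      refine denseRange_stoneCechUnit.induction_on (p := fun y => 0 ≤ u y) y
        (isClosed_le continuous_const u.continuous) fun x => ?_
      exact (Set.indicator_nonneg (fun _ _ => zero_le_one) x).trans (hKh x)
    have hu1 (y : StoneCech X) (hy : y ∈ (i '' K)ᶜ) : 1 ≤ u y := by
      have hcl : y ∈ closure ((i '' K)ᶜ ∩ Set.range i) :=
        denseRange_stoneCechUnit.open_subset_closure_inter hiK.isOpen_compl hy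
      refine closure_minimal ?_ (isClosed_le continuous_const u.continuous) hcl
      rintro _ ⟨hx, x, rfl⟩
      have hxK : x ∈ Kᶜ := fun h => hx ⟨x, h, rfl⟩
      simpa [Set.indicator_of_mem hxK] using hKh x
    refine ⟨K, hK, ?_⟩
    have hint : Integrable (fun y => u y) m := (mkOfCompact u).integrable m
    calc m (i '' K)ᶜ = ∫⁻ _ in (i '' K)ᶜ, 1 ∂m := by simp
      _ ≤ ∫⁻ y in (i '' K)ᶜ, ENNReal.ofReal (u y) ∂m :=
        setLIntegral_mono' hiK.isOpen_compl.measurableSet fun y hy => by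
          simpa using hu1 y hy
      _ ≤ ∫⁻ y, ENNReal.ofReal (u y) ∂m := setLIntegral_le_lintegral _ _
      _ = ENNReal.ofReal (∫ y, u y ∂m) :=
        (ofReal_integral_eq_lintegral_ofReal hint (ae_of_all _ hu0)).symm
      _ ≤ ENNReal.ofReal ε := ENNReal.ofReal_le_ofReal ((hm u).trans_le hlh)
  have hrange : m (Set.range i)ᶜ = 0 := by
    refine le_antisymm (ENNReal.le_of_forall_pos_le_add fun ε hε _ => ?_) zero_le
    obtain ⟨K, -, hK⟩ := hsmall ε hε
    rw [zero_add]
    calc m (Set.range i)ᶜ ≤ m (i '' K)ᶜ :=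
          measure_mono (Set.compl_subset_compl.2 (Set.image_subset_range i K))
      _ ≤ ε := by simpa using hK
  have hrangeNull : NullMeasurableSet (Set.range i) m := (NullMeasurableSet.of_null hrange).of_compl
  have himage (t : Set (StoneCech X)) : i '' (i ⁻¹' t) = t ∩ Set.range i :=
    Set.image_preimage_eq_inter_range
  have hnull (s : Set X) (hs : MeasurableSet s) : NullMeasurableSet (i '' s) m := by
    rw [BorelSpace.measurable_eq (α := X), hi.eq_induced, borel_comap] at hs
    obtain ⟨t, ht, rfl⟩ := hs
    rw [himage]
    exact MeasurableSet.nullMeasurableSet ht |>.inter hrangeNull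
  have himeas : Measurable i := hi.continuous.measurable
  have hmap : (m.comap i).map i = m := by
    ext t ht
    rw [Measure.map_apply himeas ht,
      Measure.comap_apply₀ i m hi.injective hnull (himeas ht).nullMeasurableSet, himage,
      measure_inter_conull hrange]
  refine ⟨m.comap i, ⟨?_⟩, fun g => ?_⟩
  · rw [← Set.preimage_univ (f := i), ← Measure.map_apply himeas .univ, hmap]
    exact measure_lt_top _ _
  · obtain ⟨u, rfl⟩ := stoneCechRestrict_surjective g
    rw [← hm]
    conv_rhs => rw [← hmap]
    exact (integral_map himeas.aemeasurable u.continuous.aestronglyMeasurable).symm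

end Representation

section Superhedging

lemma exists_mem_ge {X : Type*} [TopologicalSpace X] {I : Submodule ℝ (X →ᵇ ℝ)}
    (hconst : ∀ c : ℝ, BoundedContinuousFunction.const X c ∈ I) (f : X →ᵇ ℝ) :
    ∃ h ∈ (I : Set (X →ᵇ ℝ)), ∀ x, f x ≤ h x :=
  ⟨_, hconst ‖f‖, fun x => (le_abs_self _).trans (f.norm_coe_le_norm x)⟩

variable {X : Type*} [TopologicalSpace X] [MeasurableSpace X] {μ : Measure X}

lemma exists_integral_lt_phi_add {S : Set (X →ᵇ ℝ)} {f : X →ᵇ ℝ}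
    (hne : ∃ h ∈ S, ∀ x, f x ≤ h x) {ε : ℝ} (hε : 0 < ε) :
    ∃ h ∈ S, (∀ x, f x ≤ h x) ∧ ∫ x, h x ∂μ < phi μ S f + ε := by
  obtain ⟨h, hh, hfh⟩ := hne
  obtain ⟨_, ⟨k, hk, hfk, rfl⟩, hlt⟩ := exists_lt_of_csInf_lt
    (s := {r : ℝ | ∃ h ∈ S, (∀ x, f x ≤ h x) ∧ r = ∫ x, h x ∂μ}) ⟨_, h, hh, hfh, rfl⟩
    (lt_add_of_pos_right _ hε)
  exact ⟨k, hk, hfk, hlt⟩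

lemma le_phi {S : Set (X →ᵇ ℝ)} {f : X →ᵇ ℝ} {a : ℝ} (hne : ∃ h ∈ S, ∀ x, f x ≤ h x)
    (ha : ∀ h ∈ S, (∀ x, f x ≤ h x) → a ≤ ∫ x, h x ∂μ) : a ≤ phi μ S f := by
  obtain ⟨h, hh, hfh⟩ := hne
  refine le_csInf ⟨_, h, hh, hfh, rfl⟩ ?_
  rintro _ ⟨k, hk, hfk, rfl⟩
  exact ha k hk hfk

variable [OpensMeasurableSpace X] [IsProbabilityMeasure μ]

lemma integral_mono_boundedContinuous {f g : X →ᵇ ℝ} (h : ∀ x, f x ≤ g x) :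
    ∫ x, f x ∂μ ≤ ∫ x, g x ∂μ :=
  integral_mono (f.integrable μ) (g.integrable μ) h

lemma phi_le_integral {S : Set (X →ᵇ ℝ)} {f h : X →ᵇ ℝ} (hh : h ∈ S) (hfh : ∀ x, f x ≤ h x) :
    phi μ S f ≤ ∫ x, h x ∂μ := by
  refine csInf_le ⟨∫ x, f x ∂μ, ?_⟩ ⟨h, hh, hfh, rfl⟩
  rintro _ ⟨k, -, hk, rfl⟩
  exact integral_mono_boundedContinuous hk

lemma phi_anti {S T : Set (X →ᵇ ℝ)} {f : X →ᵇ ℝ} (hST : S ⊆ T)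
    (hne : ∃ h ∈ S, ∀ x, f x ≤ h x) : phi μ T f ≤ phi μ S f :=
  le_phi hne fun _ hh hfh => phi_le_integral (hST hh) hfh

/-- The superhedging functionals of an increasing sequence of sets converge to that of the
union. -/
lemma tendsto_phi_iUnion {S : ℕ → Set (X →ᵇ ℝ)} (hS : Monotone S) {f : X →ᵇ ℝ}
    (hne : ∃ h ∈ ⋃ m, S m, ∀ x, f x ≤ h x) :
    Tendsto (fun m => phi μ (S m) f) atTop (𝓝 (phi μ (⋃ m, S m) f)) := by
  refine Metric.tendsto_atTop.2 fun ε hε => ?_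
  obtain ⟨h, hh, hfh, hlt⟩ := exists_integral_lt_phi_add (μ := μ) hne hε
  obtain ⟨n, hn⟩ := Set.mem_iUnion.1 hh
  refine ⟨n, fun m hm => ?_⟩
  have h1 : phi μ (S m) f ≤ ∫ x, h x ∂μ := phi_le_integral (hS hm hn) hfh
  have h2 : phi μ (⋃ m, S m) f ≤ phi μ (S m) f :=
    phi_anti (Set.subset_iUnion S m) ⟨h, hS hm hn, hfh⟩
  rw [Real.dist_eq, abs_of_nonneg (sub_nonneg.2 h2)]
  linarith

variable {I : Submodule ℝ (X →ᵇ ℝ)}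

lemma phi_add_le (hconst : ∀ c : ℝ, BoundedContinuousFunction.const X c ∈ I) (f g : X →ᵇ ℝ) :
    phi μ (I : Set (X →ᵇ ℝ)) (f + g) ≤
      phi μ (I : Set (X →ᵇ ℝ)) f + phi μ (I : Set (X →ᵇ ℝ)) g := by
  refine le_of_forall_pos_le_add fun ε hε => ?_
  obtain ⟨h, hh, hfh, hlt⟩ :=
    exists_integral_lt_phi_add (μ := μ) (exists_mem_ge hconst f) (half_pos hε)
  obtain ⟨k, hk, hgk, hlt'⟩ :=
    exists_integral_lt_phi_add (μ := μ) (exists_mem_ge hconst g) (half_pos hε)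
  have := phi_le_integral (μ := μ) (f := f + g) (I.add_mem hh hk)
    fun x => add_le_add (hfh x) (hgk x)
  simp only [BoundedContinuousFunction.add_apply] at this
  rw [integral_add (h.integrable μ) (k.integrable μ)] at this
  linarith

lemma phi_smul_le (hconst : ∀ c : ℝ, BoundedContinuousFunction.const X c ∈ I) {c : ℝ}
    (hc : 0 < c) (f : X →ᵇ ℝ) :
    phi μ (I : Set (X →ᵇ ℝ)) (c • f) ≤ c * phi μ (I : Set (X →ᵇ ℝ)) f := by
  rw [← div_le_iff₀' hc]
  refine le_phi (exists_mem_ge hconst f) fun h hh hfh => ?_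
  rw [div_le_iff₀' hc, ← integral_const_mul]
  exact phi_le_integral (h := c • h) (I.smul_mem c hh)
    fun x => mul_le_mul_of_nonneg_left (hfh x) hc.le

lemma phi_smul (hconst : ∀ c : ℝ, BoundedContinuousFunction.const X c ∈ I) {c : ℝ}
    (hc : 0 < c) (f : X →ᵇ ℝ) :
    phi μ (I : Set (X →ᵇ ℝ)) (c • f) = c * phi μ (I : Set (X →ᵇ ℝ)) f := by
  refine le_antisymm (phi_smul_le hconst hc f) ?_
  have := phi_smul_le (μ := μ) hconst (inv_pos.2 hc) (c • f)
  rwa [inv_smul_smul₀ hc.ne', ← div_eq_inv_mul, le_div_iff₀' hc] at this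

/-- By Hahn–Banach, the superhedging functional is attained by a dominated linear functional. -/
lemma exists_linearMap_le_phi (hconst : ∀ c : ℝ, BoundedContinuousFunction.const X c ∈ I)
    (f : X →ᵇ ℝ) :
    ∃ l : (X →ᵇ ℝ) →ₗ[ℝ] ℝ, l f = phi μ (I : Set (X →ᵇ ℝ)) f ∧
      ∀ g, l g ≤ phi μ (I : Set (X →ᵇ ℝ)) g := by
  set N : (X →ᵇ ℝ) → ℝ := phi μ (I : Set (X →ᵇ ℝ)) with hN
  have hsmul (c : ℝ) (hc : 0 < c) (g : X →ᵇ ℝ) : N (c • g) = c * N g := phi_smul hconst hc g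
  have hadd (g k : X →ᵇ ℝ) : N (g + k) ≤ N g + N k := phi_add_le hconst g k
  have h0 : N 0 = 0 := by
    have := hsmul 2 two_pos 0
    rw [smul_zero] at this
    linarith
  let p : (X →ᵇ ℝ) →ₗ.[ℝ] ℝ :=
    LinearPMap.mkSpanSingleton' (σ := RingHom.id ℝ) f (N f) fun c hc => by
      rcases smul_eq_zero.1 hc with rfl | rfl <;> simp [h0]
  have hp : ∀ x : p.domain, p x ≤ N x := by
    rintro ⟨x, hx⟩
    obtain ⟨c, rfl⟩ := Submodule.mem_span_singleton.1 hx
    rw [LinearPMap.mkSpanSingleton'_apply]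
    simp only [RingHom.id_apply, smul_eq_mul]
    rcases lt_trichotomy c 0 with hc | rfl | hc
    · have h1 := hsmul (-c) (neg_pos.2 hc) f
      have h2 := hadd (c • f) ((-c) • f)
      rw [← add_smul, add_neg_cancel, zero_smul, h0] at h2
      linarith
    · simp [h0]
    · exact (hsmul c hc f).ge
  obtain ⟨l, hl, hle⟩ := exists_extension_of_le_sublinear p N hsmul hadd hp
  have hf : f ∈ p.domain := Submodule.mem_span_singleton_self f
  exact ⟨l, (hl ⟨f, hf⟩).trans (LinearPMap.mkSpanSingleton'_apply_self _ _ _ _), hle⟩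

/-- If `I` allows tight superhedging, the superhedging price with `I` is the expectation under a
probability measure having the same expectations as `μ` on `I`. -/
theorem exists_measure_integral_eq_phi [T35Space X] [BorelSpace X]
    (hconst : ∀ c : ℝ, BoundedContinuousFunction.const X c ∈ I)
    (htight : ∀ ε > (0 : ℝ), ∃ h ∈ I, ∃ K : Set X, IsCompact K ∧
      (∀ x, Kᶜ.indicator (fun _ => (1 : ℝ)) x ≤ h x) ∧ ∫ x, h x ∂μ ≤ ε) (f : X →ᵇ ℝ) :
    ∃ ν : Measure X, IsProbabilityMeasure ν ∧ (∀ h ∈ I, ∫ x, h x ∂ν = ∫ x, h x ∂μ) ∧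
      ∫ x, f x ∂ν = phi μ (I : Set (X →ᵇ ℝ)) f := by
  obtain ⟨l, hlf, hl⟩ := exists_linearMap_le_phi (μ := μ) hconst f
  have hle (h) (hh : h ∈ I) : l h ≤ ∫ x, h x ∂μ :=
    (hl h).trans (phi_le_integral hh fun _ => le_rfl)
  have heq (h) (hh : h ∈ I) : l h = ∫ x, h x ∂μ := by
    refine le_antisymm (hle h hh) ?_
    have := hle (-h) (I.neg_mem hh)
    simp only [map_neg, BoundedContinuousFunction.coe_neg, Pi.neg_apply, integral_neg] at this
    linarith
  have hpos (g : X →ᵇ ℝ) (hg : 0 ≤ g) : 0 ≤ l g := by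
    have h1 := (hl (-g)).trans (phi_le_integral (h := 0) I.zero_mem fun x => neg_nonpos.2 (hg x))
    simpa using h1
  obtain ⟨ν, hν, hint⟩ := exists_measure_integral_eq_of_tight l hpos fun ε hε => by
    obtain ⟨h, hh, K, hK, hKh, hhε⟩ := htight ε hε
    exact ⟨h, K, hK, hKh, (heq h hh).trans_le hhε⟩
  refine ⟨ν, ⟨?_⟩, fun h hh => (hint h).trans (heq h hh), (hint f).trans hlf⟩
  have h1 := (hint (.const X 1)).trans (heq _ (hconst 1))
  simpa [Measure.real, ENNReal.toReal_eq_one_iff] using h1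

/-- Equality of expectations passes to functions that can be approximated in `L¹` of every
probability measure. -/
lemma integral_eq_of_forall_approx {ν : Measure X} [IsProbabilityMeasure ν]
    {S : Set (X →ᵇ ℝ)} (hS : ∀ h ∈ S, ∫ x, h x ∂ν = ∫ x, h x ∂μ) (h : X →ᵇ ℝ)
    (happrox : ∀ ε > (0 : ℝ), ∀ ρ : Measure X, IsProbabilityMeasure ρ →
      ∃ h' ∈ S, ∫ x, |h x - h' x| ∂ρ ≤ ε) :
    ∫ x, h x ∂ν = ∫ x, h x ∂μ := by
  refine eq_of_forall_dist_le fun ε hε => ?_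
  let ρ : Measure X := (2⁻¹ : NNReal) • (ν + μ)
  have hρ : IsProbabilityMeasure ρ := ⟨by
    simp only [ρ, Measure.smul_apply, Measure.add_apply, measure_univ, ENNReal.smul_def,
      smul_eq_mul, one_add_one_eq_two]
    rw [ENNReal.coe_inv two_ne_zero]
    exact ENNReal.inv_mul_cancel two_ne_zero (by simp)⟩
  obtain ⟨k, hk, hkε⟩ := happrox (ε / 2) (half_pos hε) ρ hρ
  have hint (η : Measure X) [IsProbabilityMeasure η] : Integrable (fun x => |h x - k x|) η :=
    ((h - k).integrable η).abs
  have hbound (η : Measure X) [IsProbabilityMeasure η] :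
      |∫ x, h x ∂η - ∫ x, k x ∂η| ≤ ∫ x, |h x - k x| ∂η := by
    rw [← integral_sub (h.integrable η) (k.integrable η)]
    exact abs_integral_le_integral_abs
  rw [integral_smul_nnreal_measure, integral_add_measure (hint ν) (hint μ), NNReal.smul_def,
    smul_eq_mul, NNReal.coe_inv, NNReal.coe_ofNat] at hkε
  have h1 := abs_le.1 (hbound ν)
  have h2 := abs_le.1 (hbound μ)
  have h3 := hS k hk
  rw [Real.dist_eq, abs_le]
  constructor <;> linarith

end Superhedging

/-- If `H^1 ⊆ H^2 ⊆ ⋯ ⊆ H` with union `H^∞` a linear subspace of `C_b(X)`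
containing the constants, `φ` is continuous from above, and Condition (D) holds, then
`lim_{m→∞} φ^m(f) = φ^∞(f) = φ(f)` for every `f ∈ C_b(X)`. -/
theorem statement9 {X : Type*} [TopologicalSpace X] [PolishSpace X]
    [MeasurableSpace X] [BorelSpace X]
    (μ0 : Measure X) [IsProbabilityMeasure μ0]
    (H : Submodule ℝ (X →ᵇ ℝ))
    (hconst : ∀ c : ℝ, BoundedContinuousFunction.const X c ∈ H)
    (hca : ∀ fn : ℕ → X →ᵇ ℝ, (∀ x, Antitone (fun n => fn n x)) →
      (∀ x, Tendsto (fun n => fn n x) atTop (𝓝 (0 : ℝ))) →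
      Tendsto (fun n => phi μ0 (H : Set (X →ᵇ ℝ)) (fn n)) atTop (𝓝 (0 : ℝ)))
    (Hm : ℕ → Set (X →ᵇ ℝ))
    (hHmsub : ∀ m, Hm m ⊆ (H : Set (X →ᵇ ℝ))) (hHmmono : Monotone Hm)
    (haddI : ∀ g ∈ ⋃ m, Hm m, ∀ h ∈ ⋃ m, Hm m, g + h ∈ ⋃ m, Hm m)
    (hsmulI : ∀ c : ℝ, ∀ h ∈ ⋃ m, Hm m, c • h ∈ ⋃ m, Hm m)
    (hconstI : ∀ c : ℝ, BoundedContinuousFunction.const X c ∈ ⋃ m, Hm m)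
    (hD1 : ∀ ε > (0 : ℝ), ∀ μ : Measure X, IsProbabilityMeasure μ →
      ∀ h ∈ H, ∃ h' ∈ ⋃ m, Hm m, ∫ x, |h x - h' x| ∂μ ≤ ε)
    (hD2 : ∀ ε > (0 : ℝ), ∀ μ : Measure X, IsProbabilityMeasure μ →
      ∃ h'' ∈ ⋃ m, Hm m, ∃ K : Set X, IsCompact K ∧
        (∀ x, Kᶜ.indicator (fun _ => (1 : ℝ)) x ≤ h'' x) ∧ ∫ x, h'' x ∂μ ≤ ε)
    (f : X →ᵇ ℝ) :
    Tendsto (fun m => phi μ0 (Hm m) f) atTop (𝓝 (phi μ0 (H : Set (X →ᵇ ℝ)) f)) ∧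
      phi μ0 (⋃ m, Hm m) f = phi μ0 (H : Set (X →ᵇ ℝ)) f := by
  let I : Submodule ℝ (X →ᵇ ℝ) :=
    { carrier := ⋃ m, Hm m
      add_mem' := fun hg hh => haddI _ hg _ hh
      zero_mem' := hconstI 0
      smul_mem' := fun c h hh => hsmulI c h hh }
  have hne : ∃ h ∈ ⋃ m, Hm m, ∀ x, f x ≤ h x := exists_mem_ge (I := I) hconstI f
  have heq : phi μ0 (⋃ m, Hm m) f = phi μ0 (H : Set (X →ᵇ ℝ)) f := by
    refine le_antisymm ?_ (phi_anti (Set.iUnion_subset hHmsub) hne)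
    let := TopologicalSpace.upgradeIsCompletelyMetrizable X
    obtain ⟨ν, hν, hνI, hνf⟩ := exists_measure_integral_eq_phi (μ := μ0) (I := I) hconstI
      (fun ε hε => hD2 ε hε μ0 inferInstance) f
    refine le_phi (exists_mem_ge hconst f) fun h hh hfh => ?_
    calc phi μ0 (⋃ m, Hm m) f = ∫ x, f x ∂ν := hνf.symm
      _ ≤ ∫ x, h x ∂ν := integral_mono_boundedContinuous hfh
      _ = ∫ x, h x ∂μ0 := integral_eq_of_forall_approx hνI h fun ε hε ρ hρ => hD1 ε hε ρ hρ h hh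
  exact ⟨heq ▸ tendsto_phi_iUnion hHmmono hne, heq⟩
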